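/- arXiv:math/0312320 — 3 statements merged into one kernel-verified Lean document; each statement's English description precedes it below -/
import Mathlib

section
/- Let q ∈ ℕ, q ≥ 2. Then δ(K⁰_{1,q}) = δ(K_{1,q}) = 1/q, where K⁰_{1,q} = {1, 2, …, q−1} and K_{1,q} = {qν + k : ν ∈ ℤ_{≥0}, k ∈ K⁰_{1,q}}. -/
open Real

/-- Evaluation of the trigonometric polynomial with (finitely supported) cosine
coefficients `c` at the point `x`:  `T(x) = Σ_k c k · cos(2πkx)`.
The constant term is the `k = 0` coefficient. -/
noncomputable def trigEval (c : ℕ →₀ ℝ) (x : ℝ) : ℝ :=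
  c.sum fun k a => a * Real.cos (2 * π * k * x)

/-- The class `𝐓(K)`: trigonometric polynomials `T(x) = T₀ + Σ_{k ∈ K} T_k cos(2πkx)`
(nonzero-frequency coefficients supported in `K`), with `T(x) ≥ 0` for all `x`
and `T(0) = 1`.  A polynomial is represented by its coefficient function. -/
def TrigClass (K : Set ℕ) : Set (ℕ →₀ ℝ) :=
  {c | (∀ k : ℕ, k ≠ 0 → c k ≠ 0 → k ∈ K) ∧
       (∀ x : ℝ, 0 ≤ trigEval c x) ∧
       trigEval c 0 = 1}

/-- `δ(K) = inf_{T ∈ 𝐓(K)} T₀`. -/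
noncomputable def delta (K : Set ℕ) : ℝ :=
  sInf ((fun c : ℕ →₀ ℝ => c 0) '' TrigClass K)

/-- The Turán class `K(h)`, described by the cosine coefficient sequence `a`:
`a_n ≥ 0`, `Σ a_n = 1` (i.e. `f(0) = 1`), and
`f(x) = Σ_n a_n cos(2πnx) = 0` for `h ≤ |x| ≤ 1/2`. -/
def TuranClass (h : ℝ) : Set (ℕ → ℝ) :=
  {a | (∀ n, 0 ≤ a n) ∧ Summable a ∧ (∑' n, a n) = 1 ∧
       ∀ x : ℝ, h ≤ |x| → |x| ≤ 1 / 2 →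
         (∑' n : ℕ, a n * Real.cos (2 * π * n * x)) = 0}

/-- `A(h) = sup_{f ∈ K(h)} a₀`. -/
noncomputable def turanA (h : ℝ) : ℝ :=
  sSup ((fun a : ℕ → ℝ => a 0) '' TuranClass h)

/-- `K⁰_{p,q} = {p, p+1, …, q−p}`. -/
def Kset0 (p q : ℕ) : Set ℕ := {k | p ≤ k ∧ k ≤ q - p}

/-- `K_{p,q} = {qν + k : ν ∈ ℤ₊, k ∈ K⁰_{p,q}}`. -/
def Kset (p q : ℕ) : Set ℕ :=
  {k | ∃ ν k' : ℕ, k = q * ν + k' ∧ p ≤ k' ∧ k' ≤ q - p}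


lemma cos_sum_aux (q k : ℕ) (hq : 2 ≤ q) (hk : ¬ q ∣ k) :
    ∑ j ∈ Finset.range q, Real.cos (2 * π * k * ((j : ℝ) / q)) = 0 := by
  have hq0 : q ≠ 0 := by omega
  have hp := Complex.isPrimitiveRoot_exp q hq0
  set z : ℂ := Complex.exp (2 * π * Complex.I / q) with hz
  have h1 : z ^ k ≠ 1 := fun h => hk ((hp.pow_eq_one_iff_dvd k).1 h)
  have h2 : ∑ j ∈ Finset.range q, (z ^ k) ^ j = 0 := by
    rw [geom_sum_eq h1, ← pow_mul, mul_comm, pow_mul, hp.pow_eq_one]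
    simp
  have h3 := congrArg Complex.re h2
  rw [Complex.re_sum] at h3
  rw [Complex.zero_re] at h3
  rw [← h3]
  refine Finset.sum_congr rfl fun j _ => ?_
  rw [hz, ← pow_mul, ← Complex.exp_nat_mul, ← Complex.exp_ofReal_mul_I_re]
  congr 2
  push_cast
  ring

lemma trig_sum (s : Finset ℕ) (f : ℕ → ℕ →₀ ℝ) (x : ℝ) :
    trigEval (∑ i ∈ s, f i) x = ∑ i ∈ s, trigEval (f i) x := by
  unfold trigEval
  rw [Finsupp.sum_finsetSum_index]
  · intro; simp
  · intros; ring

lemma lower_aux (q : ℕ) (hq : 2 ≤ q) (c : ℕ →₀ ℝ) (hc : c ∈ TrigClass (Kset 1 q)) :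
    1 / (q : ℝ) ≤ c 0 := by
  obtain ⟨h1, h2, h3⟩ := hc
  have hqp : (0 : ℝ) < q := by positivity
  have key : ∑ j ∈ Finset.range q, trigEval c ((j : ℝ) / q) = q * c 0 := by
    unfold trigEval Finsupp.sum
    rw [Finset.sum_comm]
    have : ∀ k ∈ c.support, ∑ j ∈ Finset.range q, c k * Real.cos (2 * π * k * ((j : ℝ) / q))
        = if k = 0 then q * c 0 else 0 := by
      intro k hk
      rw [← Finset.mul_sum]
      split_ifs with h
      · subst h
        simp [mul_comm]
      · rw [cos_sum_aux q k hq, mul_zero]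
        obtain ⟨ν, k', rfl, ha, hb⟩ := h1 k h (Finsupp.mem_support_iff.1 hk)
        intro hd
        have := (Nat.dvd_add_right (Dvd.intro ν rfl)).1 hd
        have := Nat.le_of_dvd (by omega) this
        omega
    rw [Finset.sum_congr rfl this, Finset.sum_ite_eq']
    split_ifs with h
    · rfl
    · rw [Finsupp.notMem_support_iff.1 h, mul_zero]
  have : trigEval c (((0 : ℕ) : ℝ) / q) ≤ ∑ j ∈ Finset.range q, trigEval c ((j : ℝ) / q) :=
    Finset.single_le_sum (f := fun j : ℕ => trigEval c ((j : ℝ) / q))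
      (fun j _ => h2 _) (Finset.mem_range.2 (by omega))
  rw [key] at this
  simp only [Nat.cast_zero, zero_div, h3] at this
  rw [div_le_iff₀ hqp]
  linarith

noncomputable def fej (q : ℕ) : ℕ →₀ ℝ :=
  ∑ i ∈ Finset.range q, ∑ j ∈ Finset.range q,
    Finsupp.single ((i : ℤ) - j).natAbs (1 / (q : ℝ) ^ 2)

lemma fej_eval (q : ℕ) (x : ℝ) : trigEval (fej q) x = 1 / (q : ℝ) ^ 2 *
    ((∑ i ∈ Finset.range q, Real.cos (2 * π * i * x)) ^ 2 +
     (∑ i ∈ Finset.range q, Real.sin (2 * π * i * x)) ^ 2) := by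
  unfold fej
  rw [trig_sum, sq (Finset.sum _ _), sq (Finset.sum _ _), Finset.sum_mul_sum, Finset.sum_mul_sum,
    ← Finset.sum_add_distrib, Finset.mul_sum]
  refine Finset.sum_congr rfl fun i _ => ?_
  rw [trig_sum, ← Finset.sum_add_distrib, Finset.mul_sum]
  refine Finset.sum_congr rfl fun j _ => ?_
  unfold trigEval
  rw [Finsupp.sum_single_index (by simp), ← Real.cos_sub]
  congr 1
  rw [Nat.cast_natAbs]
  push_cast
  rcases abs_choice ((i : ℝ) - j) with h | h <;> rw [h]
  · ring_nf
  · rw [← Real.cos_neg]; ring_nf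

lemma fej_zero (q : ℕ) (hq : 2 ≤ q) : fej q 0 = 1 / q := by
  have hqp : (q : ℝ) ≠ 0 := by positivity
  unfold fej
  simp only [Finsupp.finsetSum_apply, Finsupp.single_apply]
  have : ∀ i ∈ Finset.range q, (∑ j ∈ Finset.range q,
      if ((i : ℤ) - j).natAbs = 0 then 1 / (q : ℝ) ^ 2 else 0) = 1 / (q : ℝ) ^ 2 := by
    intro i hi
    have h : ∀ j : ℕ, (((i : ℤ) - j).natAbs = 0) = (i = j) := by
      intro j; apply propext; omega
    simp only [h]
    rw [Finset.sum_ite_eq, if_pos hi]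
  rw [Finset.sum_congr rfl this]
  simp
  field_simp

lemma fej_mem (q : ℕ) (hq : 2 ≤ q) : fej q ∈ TrigClass (Kset0 1 q) := by
  have hqp : (q : ℝ) ≠ 0 := by positivity
  refine ⟨?_, ?_, ?_⟩
  · intro k hk hc
    by_contra hK
    apply hc
    unfold fej
    simp only [Finsupp.finsetSum_apply, Finsupp.single_apply]
    refine Finset.sum_eq_zero fun i hi => Finset.sum_eq_zero fun j hj => ?_
    rw [if_neg]
    intro h
    apply hK
    rw [Finset.mem_range] at hi hj
    show 1 ≤ k ∧ k ≤ q - 1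
    omega
  · intro x
    rw [fej_eval]
    positivity
  · rw [fej_eval]
    simp
    field_simp

lemma K_sub (q : ℕ) : TrigClass (Kset0 1 q) ⊆ TrigClass (Kset 1 q) := by
  rintro c ⟨h1, h2⟩
  refine ⟨fun k hk hc => ⟨0, k, by simp, h1 k hk hc⟩, h2⟩

/-- Theorem 1, case `p = 1`, closed form:
`δ(K⁰_{1,q}) = δ(K_{1,q}) = 1/q` for `q ≥ 2`. -/
theorem stmt_1 (q : ℕ) (hq : 2 ≤ q) :
    delta (Kset0 1 q) = 1 / q ∧ delta (Kset 1 q) = 1 / q := by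
  constructor
  · refine IsLeast.csInf_eq ⟨⟨fej q, fej_mem q hq, fej_zero q hq⟩, ?_⟩
    rintro _ ⟨c, hc, rfl⟩
    exact lower_aux q hq c (K_sub q hc)
  · refine IsLeast.csInf_eq ⟨⟨fej q, K_sub q (fej_mem q hq), fej_zero q hq⟩, ?_⟩
    rintro _ ⟨c, hc, rfl⟩
    exact lower_aux q hq c hc
end

section
/- Let p ∈ ℕ, p ≥ 1, and let q = 2p + 1. Then δ(K⁰_{p,2p+1}) = δ(K_{p,2p+1}) = A(p/(2p+1)), where K⁰_{p,2p+1} = {p, p+1} and K_{p,2p+1} = {(2p+1)ν + k : ν ∈ ℤ_{≥0}, k ∈ {p, p+1}}. -/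
open Real

lemma trigEval_add (c d : ℕ →₀ ℝ) (x : ℝ) : trigEval (c + d) x = trigEval c x + trigEval d x := by
  unfold trigEval
  exact Finsupp.sum_add_index' (by simp) (by intros; ring)

lemma trigEval_single (k : ℕ) (a x : ℝ) :
    trigEval (Finsupp.single k a) x = a * Real.cos (2 * π * k * x) := by
  unfold trigEval
  exact Finsupp.sum_single_index (by simp)

lemma node_val (p : ℕ) (a : ℕ → ℝ) (ha : a ∈ TuranClass ((p:ℝ) / (2 * p + 1))) (k : ℕ)
    (hk : k ∈ Kset p (2 * p + 1)) :
    (∑' n : ℕ, a n * Real.cos (2 * π * k * (n / (2 * p + 1)))) = 0 := by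
  obtain ⟨-, -, -, h⟩ := ha
  obtain ⟨ν, k', rfl, h1, h2⟩ := hk
  have hq : (0:ℝ) < 2 * p + 1 := by positivity
  have hx : |(p:ℝ) / (2 * p + 1)| = p / (2 * p + 1) := abs_of_nonneg (by positivity)
  rw [← h (p / (2 * p + 1)) (by rw [hx]) (by rw [hx, div_le_div_iff₀ hq (by norm_num)]; linarith)]
  refine tsum_congr fun n => ?_
  congr 1
  have : k' = p ∨ k' = p + 1 := by omega
  rcases this with rfl | rfl
  · rw [show 2 * π * ((((2 * k' + 1) * ν + k' : ℕ)) : ℝ) * (n / (2 * k' + 1))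
      = 2 * π * n * (k' / (2 * k' + 1)) + ((ν * n : ℕ) : ℝ) * (2 * π) by
        push_cast; field_simp; ring]
    exact Real.cos_add_nat_mul_two_pi _ _
  · rw [show 2 * π * ((((2 * p + 1) * ν + (p + 1) : ℕ)) : ℝ) * (n / (2 * p + 1))
      = -(2 * π * n * (p / (2 * p + 1))) + ((ν * n + n : ℕ) : ℝ) * (2 * π) by
        push_cast; field_simp; ring]
    rw [Real.cos_add_nat_mul_two_pi, Real.cos_neg]

lemma weak_duality (p : ℕ) (a : ℕ → ℝ) (ha : a ∈ TuranClass ((p:ℝ) / (2 * p + 1)))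
    (c : ℕ →₀ ℝ) (hc : c ∈ TrigClass (Kset p (2 * p + 1))) : a 0 ≤ c 0 := by
  have hnode := node_val p a ha
  obtain ⟨h0, hs, h1, -⟩ := ha
  obtain ⟨hK, hpos, hone⟩ := hc
  have hsum : ∀ k : ℕ, Summable fun n : ℕ => a n * Real.cos (2 * π * k * (n / (2 * p + 1))) := by
    intro k
    refine Summable.of_norm_bounded hs fun n => ?_
    rw [norm_mul, Real.norm_of_nonneg (h0 n)]
    exact mul_le_of_le_one_right (h0 n) (Real.abs_cos_le_one _)
  have key : HasSum (fun n : ℕ => a n * trigEval c (n / (2 * p + 1))) (c 0) := by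
    have h : HasSum (fun n : ℕ => ∑ k ∈ c.support,
        c k * (a n * Real.cos (2 * π * k * (n / (2 * p + 1)))))
        (∑ k ∈ c.support, if k = 0 then c 0 else 0) := by
      refine hasSum_sum fun k hk => ?_
      by_cases hk0 : k = 0
      · subst hk0
        have := (hs.hasSum.mul_left (c 0))
        rw [h1] at this
        simpa using this
      · have h2 := (hsum k).hasSum.mul_left (c k)
        rw [hnode k (hK k hk0 (Finsupp.mem_support_iff.mp hk))] at h2
        simpa [hk0] using h2
    have e : (∑ k ∈ c.support, if k = 0 then c 0 else 0) = c 0 := by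
      rw [Finset.sum_ite_eq']
      split_ifs with hh
      · rfl
      · exact (Finsupp.notMem_support_iff.mp hh).symm
    rw [e] at h
    convert h using 2 with n
    unfold trigEval Finsupp.sum
    rw [Finset.mul_sum]
    exact Finset.sum_congr rfl fun k _ => by ring
  have := key.summable.le_tsum 0 (fun n _ => mul_nonneg (h0 n) (hpos _))
  rw [key.tsum_eq] at this
  simpa [hone] using this

lemma M_lower (p : ℕ) (hp : 1 ≤ p) (φ : ℝ) :
    -((2 * p + 1) * cos (π / (2 * p + 1))) ≤
      (2 * p + 1) * (cos ((2 * p + 1) * φ) * cos φ) + sin ((2 * p + 1) * φ) * sin φ := by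
  have hp' : (1:ℝ) ≤ p := by exact_mod_cast hp
  set q : ℝ := 2 * p + 1 with hq
  have hq3 : 3 ≤ q := by linarith
  set M : ℝ → ℝ := fun φ => q * (cos (q * φ) * cos φ) + sin (q * φ) * sin φ with hM
  have hcont : Continuous M := by fun_prop
  have hper : Function.Periodic M (2 * π) := by
    intro x
    simp only [hM]
    have : q * (x + 2 * π) = q * x + ((2 * p + 1 : ℕ) : ℝ) * (2 * π) := by
      rw [hq]; push_cast; ring
    rw [this, cos_add_nat_mul_two_pi, sin_add_nat_mul_two_pi, cos_add_two_pi, sin_add_two_pi]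
  obtain ⟨x0, -, hx0⟩ := isCompact_Icc.exists_isMinOn
    (Set.nonempty_Icc.mpr (by positivity : (0:ℝ) ≤ 2 * π)) hcont.continuousOn
  have hmin : ∀ y, M x0 ≤ M y := by
    intro y
    obtain ⟨z, hz, hz'⟩ := hper.exists_mem_Ico₀ (by positivity) y
    rw [hz']
    exact hx0 (Set.Ico_subset_Icc_self hz)
  refine le_trans ?_ (hmin φ)
  have hd : HasDerivAt M (-(q ^ 2 - 1) * (sin (q * x0) * cos x0)) x0 := by
    have h1 : HasDerivAt (fun x : ℝ => q * x) q x0 := by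
      simpa using (hasDerivAt_id x0).const_mul q
    have h2 := ((h1.cos.mul (hasDerivAt_cos x0)).const_mul q).add (h1.sin.mul (hasDerivAt_sin x0))
    refine HasDerivAt.congr_deriv h2 ?_
    ring
  have hz := IsLocalMin.hasDerivAt_eq_zero (Filter.Eventually.of_forall hmin) hd
  have hq1 : -(q ^ 2 - 1) ≠ 0 := by nlinarith
  have hcosq : 1 / 2 ≤ cos (π / q) := by
    rw [← cos_pi_div_three]
    apply cos_le_cos_of_nonneg_of_le_pi (by positivity) (by linarith [pi_pos])
    exact div_le_div_of_nonneg_left pi_pos.le (by norm_num) hq3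
  have hz2 := (mul_eq_zero.mp hz).resolve_left hq1
  rcases mul_eq_zero.mp hz2 with hs | hc
  · simp only [hM, hs]
    obtain ⟨k, hk⟩ := sin_eq_zero_iff.mp hs
    have hxk : x0 = k * π / q := by field_simp; linarith
    by_cases hdiv : (2 * p + 1 : ℤ) ∣ k
    · obtain ⟨m, rfl⟩ := hdiv
      have hxm : x0 = m * π := by rw [hxk]; push_cast; rw [hq]; field_simp
      have : cos (q * x0) * cos x0 = 1 := by
        have e : cos (q * x0) * cos x0 = (cos (q * x0 + x0) + cos (q * x0 - x0)) / 2 := by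
          rw [cos_add, cos_sub]; ring
        rw [e, show q * x0 + x0 = ((m * (p + 1) : ℤ) : ℝ) * (2 * π) by
            rw [hxm, hq]; push_cast; ring,
          show q * x0 - x0 = ((m * p : ℤ) : ℝ) * (2 * π) by rw [hxm, hq]; push_cast; ring,
          cos_int_mul_two_pi, cos_int_mul_two_pi]
        norm_num
      rw [this]; nlinarith
    · have habs : |cos x0| ≤ cos (π / q) := by
        set r := k % (2 * p + 1 : ℤ) with hr
        set m := k / (2 * p + 1 : ℤ) with hm
        have hkr : k = r + (2 * p + 1) * m := (Int.emod_add_mul_ediv k _).symm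
        have hr0 : 1 ≤ r := by
          have h1 := Int.emod_nonneg k (by omega : (2 * p + 1 : ℤ) ≠ 0)
          have h2 : r ≠ 0 := fun h => hdiv (Int.dvd_of_emod_eq_zero h)
          omega
        have hr1 : r ≤ 2 * p := by
          have := Int.emod_lt_of_pos k (by omega : (0 : ℤ) < 2 * p + 1)
          omega
        have hr0' : (1:ℝ) ≤ r := by exact_mod_cast hr0
        have hr1' : (r:ℝ) ≤ q - 1 := by
          have : (r:ℝ) ≤ 2 * p := by exact_mod_cast hr1
          linarith
        have hqp : 0 < q := by linarith
        have e : x0 = r * π / q + m * π := by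
          rw [hxk, hkr]; push_cast; rw [← hq]; field_simp
        rw [e, cos_add_int_mul_pi, abs_mul, abs_zpow, abs_neg, abs_one, one_zpow, one_mul, abs_le]
        constructor
        · rw [← cos_pi_sub]
          apply cos_le_cos_of_nonneg_of_le_pi
          · positivity
          · linarith [div_pos pi_pos hqp]
          · rw [div_le_iff₀ hqp, sub_mul, div_mul_cancel₀ _ hqp.ne']
            nlinarith [pi_pos]
        · apply cos_le_cos_of_nonneg_of_le_pi
          · positivity
          · rw [div_le_iff₀ hqp]
            nlinarith [pi_pos]
          · gcongr
            nlinarith [pi_pos]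
      have h3 : |cos (q * x0) * cos x0| ≤ cos (π / q) := by
        rw [abs_mul]
        calc _ ≤ 1 * cos (π / q) := mul_le_mul (abs_cos_le_one _) habs (abs_nonneg _) (by norm_num)
          _ = _ := one_mul _
      have := (abs_le.mp h3).1
      nlinarith
  · simp only [hM, hc]
    have h3 : |sin (q * x0) * sin x0| ≤ 1 := by
      rw [abs_mul]
      exact mul_le_one₀ (abs_sin_le_one _) (abs_nonneg _) (abs_sin_le_one _)
    have := (abs_le.mp h3).1
    nlinarith

lemma dirichlet_sum (p : ℕ) (θ : ℝ) :
    (1 + 2 * ∑ j ∈ Finset.range p, cos ((j + 1) * θ)) * sin (θ / 2) = sin ((2 * p + 1) * (θ / 2)) := by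
  induction p with
  | zero => simp
  | succ p ih =>
    rw [Finset.sum_range_succ, mul_add, ← add_assoc, add_mul, ih]
    push_cast
    rw [show (2 * ((p:ℝ) + 1) + 1) * (θ / 2) = (p + 1) * θ + θ / 2 by ring,
      show (2 * (p:ℝ) + 1) * (θ / 2) = (p + 1) * θ - θ / 2 by ring, sin_add, sin_sub]
    ring

lemma dirichlet_zero (p : ℕ) (m : ℤ) (hm : ¬ (2 * p + 1 : ℤ) ∣ m) :
    1 + 2 * ∑ j ∈ Finset.range p, cos ((j + 1) * (2 * π * m / (2 * p + 1))) = 0 := by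
  have h := dirichlet_sum p (2 * π * m / (2 * p + 1))
  have hq : (2 * p + 1 : ℝ) ≠ 0 := by positivity
  rw [show (2 * (p:ℝ) + 1) * (2 * π * m / (2 * p + 1) / 2) = m * π by field_simp,
    sin_int_mul_pi] at h
  refine (mul_eq_zero.mp h).resolve_right fun h0 => ?_
  obtain ⟨k, hk⟩ := sin_eq_zero_iff.mp h0
  apply hm
  refine ⟨k, ?_⟩
  have : (m:ℝ) = (2 * p + 1) * k := by
    field_simp at hk
    linarith
  exact_mod_cast this

lemma dirichlet_q (p : ℕ) (m : ℤ) (hm : (2 * p + 1 : ℤ) ∣ m) :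
    1 + 2 * ∑ j ∈ Finset.range p, cos ((j + 1) * (2 * π * m / (2 * p + 1))) = 2 * p + 1 := by
  obtain ⟨k, rfl⟩ := hm
  have hq : (2 * p + 1 : ℝ) ≠ 0 := by positivity
  have : ∀ j ∈ Finset.range p,
      cos ((j + 1) * (2 * π * (((2 * p + 1) * k : ℤ) : ℝ) / (2 * p + 1))) = 1 := by
    intro j _
    rw [show ((j:ℝ) + 1) * (2 * π * (((2 * p + 1) * k : ℤ) : ℝ) / (2 * p + 1)) =
      ((((j:ℤ) + 1) * k : ℤ) : ℝ) * (2 * π) by push_cast; field_simp]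
    exact cos_int_mul_two_pi _
  rw [Finset.sum_congr rfl this]
  simp; ring

/-- weights -/
noncomputable def wW (p : ℕ) (n : ℕ) : ℝ :=
  1 + 2 * ∑ j ∈ Finset.range p,
    cos (2 * π * (j + 1) / (2 * p + 1)) * cos (2 * π * n * ((j + 1) / (2 * p + 1)))

lemma wW_eq (p n : ℕ) : wW p n =
    ((1 + 2 * ∑ j ∈ Finset.range p, cos ((j + 1) * (2 * π * ((n - 1 : ℤ) : ℝ) / (2 * p + 1)))) +
    (1 + 2 * ∑ j ∈ Finset.range p, cos ((j + 1) * (2 * π * ((n + 1 : ℤ) : ℝ) / (2 * p + 1))))) / 2 := by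
  unfold wW
  have : ∀ j ∈ Finset.range p,
      cos (2 * π * (j + 1) / (2 * p + 1)) * cos (2 * π * n * ((j + 1) / (2 * p + 1))) =
      (cos ((j + 1) * (2 * π * ((n - 1 : ℤ) : ℝ) / (2 * p + 1))) +
        cos ((j + 1) * (2 * π * ((n + 1 : ℤ) : ℝ) / (2 * p + 1)))) / 2 := by
    intro j _
    rw [show ((j:ℝ) + 1) * (2 * π * ((n - 1 : ℤ) : ℝ) / (2 * p + 1)) =
        2 * π * n * ((j + 1) / (2 * p + 1)) - 2 * π * (j + 1) / (2 * p + 1) by push_cast; ring,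
      show ((j:ℝ) + 1) * (2 * π * ((n + 1 : ℤ) : ℝ) / (2 * p + 1)) =
        2 * π * n * ((j + 1) / (2 * p + 1)) + 2 * π * (j + 1) / (2 * p + 1) by push_cast; ring,
      cos_sub, cos_add]
    ring
  rw [Finset.sum_congr rfl this, ← Finset.sum_div, Finset.sum_add_distrib]
  ring

lemma dirichlet_nonneg (p : ℕ) (m : ℤ) :
    0 ≤ 1 + 2 * ∑ j ∈ Finset.range p, cos ((j + 1) * (2 * π * m / (2 * p + 1))) := by
  by_cases hm : (2 * p + 1 : ℤ) ∣ m
  · rw [dirichlet_q p m hm]; positivity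
  · rw [dirichlet_zero p m hm]

lemma wW_nonneg (p n : ℕ) : 0 ≤ wW p n := by
  rw [wW_eq]
  have := dirichlet_nonneg p (n - 1)
  have := dirichlet_nonneg p (n + 1)
  positivity

lemma wW_one (p : ℕ) : 0 < wW p 1 := by
  rw [wW_eq]
  have h2 := dirichlet_nonneg p ((1:ℕ) + 1)
  have h1 := dirichlet_q p ((1:ℕ) - 1) (by simp)
  have : (0:ℝ) < 2 * p + 1 := by positivity
  linarith

lemma wW_zero (p : ℕ) (hp : 1 ≤ p) : wW p 0 = 0 := by
  rw [wW_eq, dirichlet_zero, dirichlet_zero]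
  · simp
  · intro h
    have := Int.le_of_dvd (by simp) h
    push_cast at this; omega
  · intro h
    have h := (dvd_neg (α := ℤ)).mpr h
    have := Int.le_of_dvd (by simp) h
    push_cast at this; omega

lemma wW_cos (p n : ℕ) : wW p n * cos (2 * π * n * (p / (2 * p + 1))) =
    wW p n * (- cos (π / (2 * p + 1))) := by
  have hq : (2 * p + 1 : ℝ) ≠ 0 := by positivity
  have e : - cos (π / (2 * p + 1)) = cos (2 * π * (p / (2 * p + 1))) := by
    rw [← cos_pi_sub]; congr 1; field_simp; ring
  by_cases h1 : (2 * p + 1 : ℤ) ∣ (n - 1 : ℤ)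
  · obtain ⟨k, hk⟩ := h1
    have hk' : (n:ℝ) = 1 + (2 * p + 1) * k := by
      have : (n:ℤ) = 1 + (2 * p + 1) * k := by linarith
      exact_mod_cast this
    congr 1
    rw [e, hk', show 2 * π * (1 + (2 * p + 1) * k) * ((p:ℝ) / (2 * p + 1)) =
      2 * π * (p / (2 * p + 1)) + ((k * p : ℤ) : ℝ) * (2 * π) by push_cast; field_simp,
      cos_add_int_mul_two_pi]
  by_cases h2 : (2 * p + 1 : ℤ) ∣ (n + 1 : ℤ)
  · obtain ⟨k, hk⟩ := h2
    have hk' : (n:ℝ) = -1 + (2 * p + 1) * k := by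
      have : (n:ℤ) = -1 + (2 * p + 1) * k := by linarith
      exact_mod_cast this
    congr 1
    rw [e, hk', show 2 * π * (-1 + (2 * p + 1) * k) * ((p:ℝ) / (2 * p + 1)) =
      -(2 * π * (p / (2 * p + 1))) + ((k * p : ℤ) : ℝ) * (2 * π) by push_cast; field_simp,
      cos_add_int_mul_two_pi, cos_neg]
  rw [wW_eq, dirichlet_zero p _ h1, dirichlet_zero p _ h2]; simp

lemma bern_sum (x : ℝ) (h0 : 0 ≤ x) (h1 : x ≤ 1) :
    HasSum (fun n : ℕ => 1 / (n : ℝ) ^ 2 * Real.cos (2 * π * n * x))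
      (π ^ 2 * ((x - 1 / 2) ^ 2 - 1 / 12)) := by
  have h := hasSum_one_div_nat_pow_mul_cos (k := 1) one_ne_zero (x := x) ⟨h0, h1⟩
  convert h using 1
  simp [Polynomial.bernoulli, Finset.sum_range_succ, bernoulli_eq_bernoulli'_of_ne_one]
  norm_num [Nat.factorial, Nat.choose]
  ring

lemma main_sum (p : ℕ) (hp : 1 ≤ p) : ∃ C : ℝ, ∀ t : ℝ, |t| ≤ 1 / (2 * (2 * p + 1)) →
    HasSum (fun n : ℕ => wW p n * (1 / (n:ℝ) ^ 2) * cos (2 * π * n * (1 / 2 + t))) C := by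
  have hq : (0:ℝ) < 2 * p + 1 := by positivity
  refine ⟨π ^ 2 * (2 * ∑ j ∈ Finset.range p,
    cos (2 * π * (j + 1) / (2 * p + 1)) * ((j + 1) / (2 * p + 1)) ^ 2), fun t ht => ?_⟩
  obtain ⟨ht1, ht2⟩ := abs_le.mp ht
  have hb : (1:ℝ) / (2 * (2 * p + 1)) ≤ 1 / 2 := by
    rw [div_le_div_iff₀ (by positivity) (by norm_num)]
    have : (0:ℝ) ≤ p := by positivity
    linarith
  have hj : ∀ j ∈ Finset.range p, ((j:ℝ) + 1) / (2 * p + 1) + 1 / (2 * (2 * p + 1)) ≤ 1 / 2 := by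
    intro j hj
    have : (j:ℝ) + 1 ≤ p := by exact_mod_cast Finset.mem_range.mp hj
    rw [show ((j:ℝ) + 1) / (2 * p + 1) + 1 / (2 * (2 * p + 1)) =
      (2 * (j + 1) + 1) / (2 * (2 * p + 1)) by field_simp, div_le_div_iff₀ (by positivity) (by norm_num)]
    linarith
  have hS := (bern_sum (1 / 2 + t) (by linarith) (by linarith)).add
    (hasSum_sum (s := Finset.range p) (f := fun (j n : ℕ) =>
      cos (2 * π * (j + 1) / (2 * p + 1)) *
      (1 / (n : ℝ) ^ 2 * Real.cos (2 * π * n * (1 / 2 + t + (j + 1) / (2 * p + 1))) +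
      1 / (n : ℝ) ^ 2 * Real.cos (2 * π * n * (1 / 2 + t - (j + 1) / (2 * p + 1)))))
      (a := fun j : ℕ => cos (2 * π * (j + 1) / (2 * p + 1)) *
      (π ^ 2 * ((1 / 2 + t + (j + 1) / (2 * p + 1) - 1 / 2) ^ 2 - 1 / 12) +
        π ^ 2 * ((1 / 2 + t - (j + 1) / (2 * p + 1) - 1 / 2) ^ 2 - 1 / 12)))
      fun j hj' => by
        have h1 := hj j hj'
        have h2 : (0:ℝ) ≤ (j + 1) / (2 * p + 1) := by positivity
        exact ((bern_sum _ (by linarith) (by linarith)).add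
          (bern_sum _ (by linarith) (by linarith))).mul_left _)
  convert hS using 1
  · funext n
    unfold wW
    rw [mul_assoc (1 + _), add_mul, one_mul, Finset.mul_sum, Finset.sum_mul]
    congr 1
    refine Finset.sum_congr rfl fun j _ => ?_
    rw [mul_add (2 * π * (n:ℝ)) (1 / 2 + t), mul_sub (2 * π * (n:ℝ)) (1 / 2 + t), cos_add, cos_sub]
    ring
  · have h0 : (1:ℝ) + 2 * ∑ j ∈ Finset.range p, cos (2 * π * (j + 1) / (2 * p + 1)) = 0 := by
      have := wW_zero p hp
      unfold wW at this
      simpa using this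
    have e : ∀ j ∈ Finset.range p, cos (2 * π * ((j:ℝ) + 1) / (2 * p + 1)) *
      (π ^ 2 * ((1 / 2 + t + (j + 1) / (2 * p + 1) - 1 / 2) ^ 2 - 1 / 12) +
        π ^ 2 * ((1 / 2 + t - (j + 1) / (2 * p + 1) - 1 / 2) ^ 2 - 1 / 12)) =
      (2 * π ^ 2) * (cos (2 * π * (j + 1) / (2 * p + 1)) * ((j + 1) / (2 * p + 1)) ^ 2) +
      (2 * π ^ 2 * (t ^ 2 - 1 / 12)) * cos (2 * π * (j + 1) / (2 * p + 1)) := by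
      intro j _; ring
    rw [Finset.sum_congr rfl e, Finset.sum_add_distrib, ← Finset.mul_sum, ← Finset.mul_sum]
    linear_combination (-π ^ 2 * (t ^ 2 - 1 / 12)) * h0

lemma b_summable (p : ℕ) : Summable fun n : ℕ => wW p n * (1 / (n:ℝ) ^ 2) := by
  refine Summable.of_norm_bounded
    (((Real.summable_one_div_nat_pow (p := 2)).mpr (by norm_num)).mul_left (2 * (p:ℝ) + 1)) fun n => ?_
  rw [norm_mul, Real.norm_of_nonneg (wW_nonneg p n), Real.norm_of_nonneg (by positivity)]
  gcongr
  rw [wW]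
  have : ∑ j ∈ Finset.range p,
    cos (2 * π * (j + 1) / (2 * p + 1)) * cos (2 * π * n * ((j + 1) / (2 * p + 1))) ≤
      ∑ j ∈ Finset.range p, (1:ℝ) := by
    refine Finset.sum_le_sum fun j _ => ?_
    refine (le_abs_self _).trans ?_
    rw [abs_mul]
    exact mul_le_one₀ (abs_cos_le_one _) (abs_nonneg _) (abs_cos_le_one _)
  simp at this
  linarith

lemma b_pos (p : ℕ) : 0 < ∑' n : ℕ, wW p n * (1 / (n:ℝ) ^ 2) :=
  (b_summable p).tsum_pos (fun n => mul_nonneg (wW_nonneg p n) (by positivity)) 1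
    (by simpa using wW_one p)

lemma b_val (p : ℕ) (hp : 1 ≤ p) (x : ℝ) (h1 : (p:ℝ) / (2 * p + 1) ≤ |x|) (h2 : |x| ≤ 1 / 2) :
    HasSum (fun n : ℕ => wW p n * (1 / (n:ℝ) ^ 2) * cos (2 * π * n * x))
      (-(cos (π / (2 * p + 1)) * ∑' n : ℕ, wW p n * (1 / (n:ℝ) ^ 2))) := by
  obtain ⟨C, hC⟩ := main_sum p hp
  have hq : (0:ℝ) < 2 * p + 1 := by positivity
  have e0 : (p:ℝ) / (2 * p + 1) = 1 / 2 + -(1 / (2 * (2 * p + 1))) := by field_simp; ring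
  have hCv : C = -(cos (π / (2 * p + 1)) * ∑' n : ℕ, wW p n * (1 / (n:ℝ) ^ 2)) := by
    have h3 := hC (-(1 / (2 * (2 * p + 1)))) (by rw [abs_neg, abs_of_nonneg (by positivity)])
    rw [← e0] at h3
    have h4 := (b_summable p).hasSum.mul_left (-cos (π / (2 * p + 1)))
    rw [neg_mul] at h4
    refine h3.unique ?_
    have hf : (fun n : ℕ => wW p n * (1 / (n:ℝ) ^ 2) * cos (2 * π * n * (p / (2 * p + 1)))) =
        fun n : ℕ => -cos (π / (2 * p + 1)) * (wW p n * (1 / (n:ℝ) ^ 2)) := by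
      funext n
      linear_combination (1 / (n:ℝ) ^ 2) * wW_cos p n
    rw [hf]
    exact h4
  rw [← hCv]
  have h5 := hC (|x| - 1 / 2) (by
    rw [abs_of_nonpos (by linarith)]; rw [e0] at h1; linarith)
  convert h5 using 3 with n
  rw [add_sub_cancel, ← cos_abs, ← cos_abs (2 * π * n * |x|)]
  simp [abs_mul]

lemma cos_q_pos (p : ℕ) (hp : 1 ≤ p) : 0 < cos (π / (2 * p + 1)) := by
  have hp' : (1:ℝ) ≤ p := by exact_mod_cast hp
  apply cos_pos_of_mem_Ioo
  have := pi_pos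
  constructor
  · have : 0 < π / (2 * p + 1) := by positivity
    linarith
  · exact div_lt_div_of_pos_left pi_pos (by norm_num) (by linarith)

lemma exists_turan (p : ℕ) (hp : 1 ≤ p) : ∃ a ∈ TuranClass ((p:ℝ) / (2 * p + 1)),
    a 0 = cos (π / (2 * p + 1)) / (1 + cos (π / (2 * p + 1))) := by
  have hc := cos_q_pos p hp
  have hval := b_val p hp
  have hS := b_pos p
  have hsum := (b_summable p).hasSum
  set c := cos (π / (2 * p + 1)) with hcdef
  set S := ∑' n : ℕ, wW p n * (1 / (n:ℝ) ^ 2) with hSdef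
  have h1c : 0 < 1 + c := by linarith
  have hgen : ∀ (x v : ℝ), HasSum (fun n : ℕ => wW p n * (1 / (n:ℝ) ^ 2) * cos (2 * π * n * x)) v →
      HasSum (fun n : ℕ => ((if n = 0 then c / (1 + c) else 0) +
        (1 / (S * (1 + c))) * (wW p n * (1 / (n:ℝ) ^ 2))) * cos (2 * π * n * x))
        (c / (1 + c) + (1 / (S * (1 + c))) * v) := by
    intro x v hv
    convert (hasSum_ite_eq (0:ℕ) (c / (1 + c))).add (hv.mul_left (1 / (S * (1 + c)))) using 2 with n
    by_cases hn : n = 0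
    · subst hn; simp
    · simp [hn]; ring
  have hone : HasSum (fun n : ℕ => ((if n = 0 then c / (1 + c) else 0) +
        (1 / (S * (1 + c))) * (wW p n * (1 / (n:ℝ) ^ 2)))) 1 := by
    have := hgen 0 S (by simpa using hsum)
    simp only [mul_zero, cos_zero, mul_one] at this
    convert this using 1
    field_simp
    ring
  refine ⟨_, ⟨fun n => ?_, hone.summable, hone.tsum_eq, fun x hx1 hx2 => ?_⟩, ?_⟩
  · have := wW_nonneg p n
    apply add_nonneg
    · split_ifs <;> positivity
    · positivity
  · rw [(hgen x _ (hval x hx1 hx2)).tsum_eq]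
    field_simp
    ring
  · simp

lemma exists_trig (p : ℕ) (hp : 1 ≤ p) : ∃ c ∈ TrigClass (Kset0 p (2 * p + 1)),
    c 0 = cos (π / (2 * p + 1)) / (1 + cos (π / (2 * p + 1))) := by
  have hc := cos_q_pos p hp
  have hM := M_lower p hp
  set c := cos (π / (2 * p + 1)) with hcdef
  have h1c : 0 < 1 + c := by linarith
  have hq : (0:ℝ) < 2 * p + 1 := by positivity
  refine ⟨Finsupp.single 0 (c / (1 + c)) + (Finsupp.single p ((p + 1) / ((2 * p + 1) * (1 + c)))
    + Finsupp.single (p + 1) (p / ((2 * p + 1) * (1 + c)))), ⟨?_, ?_, ?_⟩, ?_⟩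
  · intro k hk hk2
    by_contra hK
    apply hk2
    have h1 : p ≠ k := by rintro rfl; exact hK ⟨le_rfl, by omega⟩
    have h2 : p + 1 ≠ k := by rintro rfl; exact hK ⟨by omega, by omega⟩
    simp [Finsupp.single_apply, h1, h2, hk.symm]
  · intro x
    rw [trigEval_add, trigEval_add, trigEval_single, trigEval_single, trigEval_single]
    have h := hM (π * x)
    rw [show 2 * π * (p:ℝ) * x = (2 * p + 1) * (π * x) - π * x by ring,
      show 2 * π * ((p + 1 : ℕ):ℝ) * x = (2 * p + 1) * (π * x) + π * x by push_cast; ring,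
      cos_sub, cos_add]
    generalize cos ((2 * p + 1) * (π * x)) = A at *
    generalize sin ((2 * p + 1) * (π * x)) = B at *
    generalize cos (π * x) = D at *
    generalize sin (π * x) = E at *
    have e : c / (1 + c) * cos (2 * π * ((0:ℕ):ℝ) * x) +
      ((p + 1) / ((2 * p + 1) * (1 + c)) * (A * D + B * E) + p / ((2 * p + 1) * (1 + c)) * (A * D - B * E))
      = ((2 * p + 1) * (A * D) + B * E + (2 * p + 1) * c) / ((2 * p + 1) * (1 + c)) := by
      simp only [Nat.cast_zero, mul_zero, zero_mul, cos_zero]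
      field_simp
      ring
    rw [e]
    apply div_nonneg (by linarith) (by positivity)
  · rw [trigEval_add, trigEval_add, trigEval_single, trigEval_single, trigEval_single]
    simp only [mul_zero, cos_zero]
    field_simp
    ring
  · have : p ≠ 0 := by omega
    simp [Finsupp.single_apply, this]

/-- Theorem 1, case `q = 2p + 1`:
`δ(K⁰_{p,2p+1}) = δ(K_{p,2p+1}) = A(p/(2p+1))` for `p ≥ 1`.
Note `K⁰_{p,2p+1} = {p, p+1}`. -/
theorem stmt_6 (p : ℕ) (hp : 1 ≤ p) :
    delta (Kset0 p (2 * p + 1)) = turanA (p / (2 * p + 1)) ∧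
    delta (Kset p (2 * p + 1)) = turanA (p / (2 * p + 1)) := by
  have hsub : TrigClass (Kset0 p (2 * p + 1)) ⊆ TrigClass (Kset p (2 * p + 1)) := by
    rintro c ⟨h1, h2⟩
    exact ⟨fun k hk hk2 => ⟨0, k, by simp, h1 k hk hk2⟩, h2⟩
  obtain ⟨a, ha, ha0⟩ := exists_turan p hp
  obtain ⟨c, hc, hc0⟩ := exists_trig p hp
  have hA : turanA (p / (2 * p + 1)) = cos (π / (2 * p + 1)) / (1 + cos (π / (2 * p + 1))) := by
    refine IsGreatest.csSup_eq ⟨⟨a, ha, ha0⟩, ?_⟩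
    rintro _ ⟨b, hb, rfl⟩
    exact (weak_duality p b hb c (hsub hc)).trans_eq hc0
  rw [hA]
  constructor
  · refine IsLeast.csInf_eq ⟨⟨c, hc, hc0⟩, ?_⟩
    rintro _ ⟨d, hd, rfl⟩
    exact ha0.symm.trans_le (weak_duality p a ha d (hsub hd))
  · refine IsLeast.csInf_eq ⟨⟨c, hsub hc, hc0⟩, ?_⟩
    rintro _ ⟨d, hd, rfl⟩
    exact ha0.symm.trans_le (weak_duality p a ha d hd)
end

section
/- Let p ∈ ℕ, p ≥ 1. Then δ(K⁰_{p,2p+1}) = δ(K_{p,2p+1}) = cos(π/(2p+1))/(1 + cos(π/(2p+1))), where K⁰_{p,2p+1} = {p, p+1} and K_{p,2p+1} = {(2p+1)ν + k : ν ∈ ℤ_{≥0}, k ∈ {p, p+1}}. -/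
open Real

lemma aux_Kset_sub (p q : ℕ) : Kset0 p q ⊆ Kset p q := by
  rintro k ⟨h1, h2⟩
  exact ⟨0, k, by simp, h1, h2⟩

lemma aux_class_mono {K L : Set ℕ} (h : K ⊆ L) : TrigClass K ⊆ TrigClass L := by
  rintro c ⟨h1, h2, h3⟩
  exact ⟨fun k hk hc => h (h1 k hk hc), h2, h3⟩

lemma aux_cos_pos (p : ℕ) (hp : 1 ≤ p) : 1 / 2 ≤ Real.cos (π / (2 * p + 1)) := by
  have hp' : (1 : ℝ) ≤ p := by exact_mod_cast hp
  rw [← Real.cos_pi_div_three]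
  apply Real.cos_le_cos_of_nonneg_of_le_pi
  · positivity
  · linarith [Real.pi_pos]
  · apply div_le_div_of_nonneg_left Real.pi_pos.le (by norm_num) (by linarith)

lemma aux_cos_Kset (p : ℕ) (k : ℕ) (hk : k ∈ Kset p (2 * p + 1)) :
    Real.cos (2 * π * k * (1 / (2 * p + 1))) = - Real.cos (π / (2 * p + 1)) := by
  have hq : (2 * p + 1 : ℝ) ≠ 0 := by positivity
  obtain ⟨ν, k', rfl, h1, h2⟩ := hk
  have : k' = p ∨ k' = p + 1 := by omega
  rw [← Real.cos_pi_sub]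
  rcases this with rfl | rfl
  · rw [← Real.cos_add_nat_mul_two_pi (π - _) ν]
    congr 1
    push_cast
    field_simp
    ring
  · rw [← Real.cos_neg (π - _),
      ← Real.cos_add_nat_mul_two_pi (-(π - π / (2 * p + 1))) (ν + 1)]
    congr 1
    push_cast
    field_simp
    ring

lemma aux_lower (p : ℕ) (hp : 1 ≤ p) (c : ℕ →₀ ℝ) (hc : c ∈ TrigClass (Kset p (2 * p + 1))) :
    Real.cos (π / (2 * p + 1)) / (1 + Real.cos (π / (2 * p + 1))) ≤ c 0 := by
  have hpos := aux_cos_pos p hp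
  obtain ⟨h1, h2, h3⟩ := hc
  have hx := h2 (1 / (2 * p + 1))
  set κ := Real.cos (π / (2 * p + 1)) with hκ
  have e : trigEval c (1 / (2 * p + 1)) = -κ * trigEval c 0 + c 0 * (1 + κ) := by
    have e0 : c 0 * (1 + κ) = ∑ k ∈ c.support, if k = 0 then c k * (1 + κ) else 0 := by
      rw [Finset.sum_ite_eq' c.support 0 (fun k => c k * (1 + κ))]
      by_cases h : c 0 = 0 <;> simp [h]
    rw [e0]
    unfold trigEval Finsupp.sum
    rw [Finset.mul_sum, ← Finset.sum_add_distrib]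
    apply Finset.sum_congr rfl
    intro k hk
    by_cases h : k = 0
    · subst h
      simp
      ring
    · beta_reduce
      rw [aux_cos_Kset p k (h1 k h (by simpa using hk))]
      simp [h, ← hκ]
      ring
  rw [e, h3] at hx
  rw [div_le_iff₀ (by linarith)]
  linarith

lemma aux_cos_odd (q : ℕ) (hq : 0 < q) (r : ℤ) (hr : Odd r) :
    Real.cos (r * (π / q)) ≤ Real.cos (π / q) := by
  have hq' : (0 : ℝ) < q := by exact_mod_cast hq
  obtain ⟨s, k, hs, h0, h2⟩ : ∃ s k : ℤ, r = s + k * (2 * q) ∧ 0 ≤ s ∧ s < 2 * q :=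
    ⟨r % (2 * q), r / (2 * q), by
      rw [mul_comm (r / _)]; exact (Int.emod_add_mul_ediv r (2 * q)).symm,
      Int.emod_nonneg _ (by omega), Int.emod_lt_of_pos _ (by omega)⟩
  have hsodd : Odd s := by
    have : s = r - 2 * (k * q) := by rw [hs]; ring
    rw [this]
    exact hr.sub_even (even_two_mul _)
  have h1 : 1 ≤ s := by
    obtain ⟨t, ht⟩ := hsodd
    omega
  have h1' : s + 1 ≤ 2 * q := by omega
  have h1r : (1 : ℝ) ≤ s := by exact_mod_cast h1
  have h1r' : (s : ℝ) + 1 ≤ 2 * q := by exact_mod_cast h1'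
  have hθ : 0 < π / q := by positivity
  have hθq : (q : ℝ) * (π / q) = π := by field_simp
  have e : Real.cos (r * (π / q)) = Real.cos (s * (π / q)) := by
    rw [← Real.cos_add_int_mul_two_pi (s * (π / q)) k, hs]
    congr 1
    push_cast
    field_simp
  rw [e]
  by_cases hsq : s ≤ q
  · have hsq' : (s : ℝ) ≤ q := by exact_mod_cast hsq
    apply Real.cos_le_cos_of_nonneg_of_le_pi hθ.le
    · nlinarith
    · nlinarith
  · have hsq' : (q : ℝ) ≤ s := by exact_mod_cast (not_le.mp hsq).le
    rw [← Real.cos_two_pi_sub]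
    apply Real.cos_le_cos_of_nonneg_of_le_pi hθ.le
    · nlinarith
    · nlinarith

lemma aux_F_nonneg (p : ℕ) (hp : 1 ≤ p) (y : ℝ) :
    0 ≤ (p + 1) * Real.cos (p * y) + p * Real.cos ((p + 1) * y)
      + (2 * p + 1) * Real.cos (π / (2 * p + 1)) := by
  have hpos := aux_cos_pos p hp
  have hp' : (1 : ℝ) ≤ p := by exact_mod_cast hp
  set F : ℝ → ℝ := fun y => (p + 1) * Real.cos (p * y) + p * Real.cos ((p + 1) * y)
      + (2 * p + 1) * Real.cos (π / (2 * p + 1)) with hF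
  have hcont : Continuous F := by fun_prop
  have hper : Function.Periodic F (2 * π) := by
    intro x
    have a1 : Real.cos (p * (x + 2 * π)) = Real.cos (p * x) := by
      rw [← Real.cos_add_nat_mul_two_pi (p * x) p]; congr 1; ring
    have a2 : Real.cos ((p + 1) * (x + 2 * π)) = Real.cos ((p + 1) * x) := by
      rw [← Real.cos_add_nat_mul_two_pi ((p + 1) * x) (p + 1)]; congr 1; push_cast; ring
    simp only [hF, a1, a2]
  have hcomp := hper.compact_of_continuous (by positivity) hcont
  obtain ⟨m, ⟨θ, hθ⟩, hm⟩ := hcomp.exists_isLeast (Set.range_nonempty F)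
  have hmin : ∀ z, F θ ≤ F z := fun z => by rw [hθ]; exact hm ⟨z, rfl⟩
  have hder : HasDerivAt F ((p + 1) * (-Real.sin (p * θ) * p)
      + p * (-Real.sin ((p + 1) * θ) * (p + 1))) θ := by
    have b1 : HasDerivAt (fun y : ℝ => (p : ℝ) * y) p θ := by
      simpa using (hasDerivAt_id θ).const_mul (p : ℝ)
    have b2 : HasDerivAt (fun y : ℝ => ((p : ℝ) + 1) * y) (p + 1) θ := by
      simpa using (hasDerivAt_id θ).const_mul ((p : ℝ) + 1)
    exact ((b1.cos.const_mul _).add (b2.cos.const_mul _)).add_const _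
  have hz := IsLocalMin.hasDerivAt_eq_zero (Filter.Eventually.of_forall hmin) hder
  have hs : Real.sin (p * θ) + Real.sin ((p + 1) * θ) = 0 := by
    have : (p * (p + 1) : ℝ) * (Real.sin (p * θ) + Real.sin ((p + 1) * θ)) = 0 := by linarith
    rcases mul_eq_zero.mp this with h | h
    · nlinarith
    · exact h
  have hs2 : Real.sin ((2 * p + 1) * (θ / 2)) * Real.cos (θ / 2) = 0 := by
    have c1 : (p : ℝ) * θ = (2 * p + 1) * (θ / 2) - θ / 2 := by ring
    have c2 : ((p : ℝ) + 1) * θ = (2 * p + 1) * (θ / 2) + θ / 2 := by ring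
    rw [c1, c2, Real.sin_sub, Real.sin_add] at hs
    linarith
  refine le_trans ?_ (hmin y)
  rcases mul_eq_zero.mp hs2 with h | h
  · obtain ⟨n, hn⟩ := Real.sin_eq_zero_iff.mp h
    have hθ' : θ = n * (2 * π) / (2 * p + 1) := by
      field_simp
      linarith
    have d1 : Real.cos ((p + 1) * θ) = Real.cos (p * θ) := by
      rw [← Real.cos_neg (p * θ), ← Real.cos_add_int_mul_two_pi (-(p * θ)) n]
      congr 1
      linarith
    have d2 : -Real.cos (p * θ) ≤ Real.cos (π / (2 * p + 1)) := by
      have := aux_cos_odd (2 * p + 1) (by omega) (2 * (p * n) + (2 * p + 1)) 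
        ((even_two_mul _).add_odd (odd_two_mul_add_one _))
      rw [← Real.cos_add_pi]
      convert this using 2
      · rw [hθ']
        push_cast
        field_simp
      · push_cast; rfl
    simp only [hF, d1]
    nlinarith
  · have e1 : Real.cos ((p + 1) * θ) = - Real.cos (p * θ) := by
      have c1 : (p : ℝ) * θ = (2 * p + 1) * (θ / 2) - θ / 2 := by ring
      have c2 : ((p : ℝ) + 1) * θ = (2 * p + 1) * (θ / 2) + θ / 2 := by ring
      rw [c1, c2, Real.cos_sub, Real.cos_add, h]
      ring
    simp only [hF, e1]
    have := Real.neg_one_le_cos (p * θ)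
    nlinarith

lemma aux_attain (p : ℕ) (hp : 1 ≤ p) : ∃ c ∈ TrigClass (Kset0 p (2 * p + 1)),
    c 0 = Real.cos (π / (2 * p + 1)) / (1 + Real.cos (π / (2 * p + 1))) := by
  have hpos := aux_cos_pos p hp
  have hp' : (1 : ℝ) ≤ p := by exact_mod_cast hp
  have hF := aux_F_nonneg p hp
  set κ := Real.cos (π / (2 * p + 1)) with hκ
  have hk1 : (1 + κ) ≠ 0 := by linarith
  have hq : (2 * p + 1 : ℝ) ≠ 0 := by positivity
  set c : ℕ →₀ ℝ := Finsupp.single 0 (κ / (1 + κ))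
    + Finsupp.single p ((p + 1) / ((2 * p + 1) * (1 + κ)))
    + Finsupp.single (p + 1) (p / ((2 * p + 1) * (1 + κ))) with hc
  have hev : ∀ x, trigEval c x = ((p + 1) * Real.cos (p * (2 * π * x))
      + p * Real.cos ((p + 1) * (2 * π * x)) + (2 * p + 1) * κ) / ((2 * p + 1) * (1 + κ)) := by
    intro x
    unfold trigEval
    rw [hc, Finsupp.sum_add_index' (by simp) (by intros; ring),
      Finsupp.sum_add_index' (by simp) (by intros; ring), Finsupp.sum_single_index (by simp),
      Finsupp.sum_single_index (by simp), Finsupp.sum_single_index (by simp)]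
    have a1 : 2 * π * p * x = p * (2 * π * x) := by ring
    have a2 : 2 * π * (p + 1 : ℕ) * x = (p + 1) * (2 * π * x) := by push_cast; ring
    rw [a1, a2]
    simp
    field_simp
    ring
  refine ⟨c, ⟨?_, ?_, ?_⟩, ?_⟩
  · intro k hk hck
    by_contra hn
    apply hck
    have n1 : p ≠ k := by
      rintro rfl; exact hn ⟨le_rfl, by omega⟩
    have n2 : p + 1 ≠ k := by
      rintro rfl; exact hn ⟨by omega, by omega⟩
    simp [hc, Finsupp.single_apply, n1, n2, Ne.symm hk]
  · intro x
    rw [hev]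
    have := hF (2 * π * x)
    apply div_nonneg this
    nlinarith
  · rw [hev]
    simp
    field_simp
    ring
  · have : p ≠ 0 := by omega
    simp [hc, Finsupp.single_apply, this]

lemma aux_delta (p : ℕ) (hp : 1 ≤ p) (K : Set ℕ) (h1 : Kset0 p (2 * p + 1) ⊆ K)
    (h2 : K ⊆ Kset p (2 * p + 1)) :
    delta K = Real.cos (π / (2 * p + 1)) / (1 + Real.cos (π / (2 * p + 1))) := by
  apply IsLeast.csInf_eq
  constructor
  · obtain ⟨c, hc, h0⟩ := aux_attain p hp
    exact ⟨c, aux_class_mono h1 hc, h0⟩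
  · rintro _ ⟨c, hc, rfl⟩
    exact aux_lower p hp c (aux_class_mono h2 hc)

/-- Theorem 1, case `q = 2p + 1`, closed form:
`δ(K⁰_{p,2p+1}) = δ(K_{p,2p+1}) = cos(π/(2p+1))/(1 + cos(π/(2p+1)))` for `p ≥ 1`. -/
theorem stmt_7 (p : ℕ) (hp : 1 ≤ p) :
    delta (Kset0 p (2 * p + 1)) =
      Real.cos (π / (2 * p + 1)) / (1 + Real.cos (π / (2 * p + 1))) ∧
    delta (Kset p (2 * p + 1)) =
      Real.cos (π / (2 * p + 1)) / (1 + Real.cos (π / (2 * p + 1))) := by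
  exact ⟨aux_delta p hp _ subset_rfl (aux_Kset_sub _ _), aux_delta p hp _ (aux_Kset_sub _ _) subset_rfl⟩
end
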